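/- (Theorem 5, concretized.) In every KID-CoPE instance there exists a legal linear policy σ* that is contiguous and lazy and is optimal: p(σ*) ≥ p(σ) for every legal linear policy σ. -/

import Mathlib

/-- `T(k)`: the number of computation entries among the first `k` entries of `σ`. -/
def compCount {n : ℕ} {B : Type*} (σ : List (Fin n ⊕ B)) (k : ℕ) : ℕ :=
  (σ.take k).countP Sum.isLeft

/-- `L(k)`: the number of base-level entries among the first `k` entries of `σ`. -/
def baseCount {n : ℕ} {B : Type*} (σ : List (Fin n ⊕ B)) (k : ℕ) : ℕ :=
  (σ.take k).countP Sum.isRight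

/-- The list of base-level entries of `σ`, in order. -/
def baseSeq {n : ℕ} {B : Type*} (σ : List (Fin n ⊕ B)) : List B :=
  σ.filterMap Sum.getRight?

/-- `F(k)`: the maximum of `0` and of `T(p) + dur(σ[p])` over all base-level
positions `p < k` (the time by which all base-level actions started before
position `k` have finished executing). -/
def finishBound {n : ℕ} {B : Type*} (dur : B → ℕ) (σ : List (Fin n ⊕ B)) (k : ℕ) : ℕ :=
  (Finset.range k).sup fun p =>
    match σ[p]? with
    | some (Sum.inr b) => compCount σ p + dur b
    | _ => 0

/-- `R_i(k)`: the total duration of the actions of `Hi` not started before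
position `k`, given that `c` base-level actions were started before position `k`. -/
def remDur {B : Type*} (dur : B → ℕ) (Hi : List B) (c : ℕ) : ℕ :=
  ((Hi.drop c).map dur).sum

/-- A linear policy `σ` is legal if (i) its base-level entries form a prefix of some
`H i`; (ii) base-level executions do not overlap; and (iii) every computation entry
`c i` is valid and non-tardy. -/
def Legal {n : ℕ} {B : Type*} (dur : B → ℕ) (H : Fin n → List B) (d : Fin n → ℕ)
    (σ : List (Fin n ⊕ B)) : Prop :=
  (∃ i, baseSeq σ <+: H i) ∧
  (∀ q (b : B), σ[q]? = some (Sum.inr b) → finishBound dur σ q ≤ compCount σ q) ∧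
  (∀ k (i : Fin n), σ[k]? = some (Sum.inl i) →
    baseSeq (σ.take k) <+: H i ∧
    max (compCount σ k + 1) (finishBound dur σ k) +
        remDur dur (H i) (baseCount σ k) ≤ d i)

/-- The success probability `p(σ) = 1 - ∏ᵢ (1 - Mᵢ(nᵢ(σ)))` of a legal linear policy,
where `nᵢ(σ)` is the number of computation entries `c i` in `σ`. -/
noncomputable def policyP {n : ℕ} {B : Type*} [DecidableEq B] (M : Fin n → ℕ → ℝ)
    (σ : List (Fin n ⊕ B)) : ℝ :=
  1 - ∏ i, (1 - M i (σ.count (Sum.inl i)))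

/-- `σ` is contiguous: no computation entry of another process occurs between two
computation entries of the same process. -/
def Contiguous {n : ℕ} {B : Type*} (σ : List (Fin n ⊕ B)) : Prop :=
  ∀ (p q r : ℕ) (i j : Fin n), p < q → q < r →
    σ[p]? = some (Sum.inl i) → σ[r]? = some (Sum.inl i) →
    σ[q]? = some (Sum.inl j) → j = i

/-- A policy `σ` is lazy: swapping any base-level entry with the immediately following entry
yields an illegal (or tardy) policy. -/
def Lazy {n : ℕ} {B : Type*} (dur : B → ℕ) (H : Fin n → List B) (d : Fin n → ℕ)
    (σ : List (Fin n ⊕ B)) : Prop :=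
  ∀ (k : ℕ) (e e' : Fin n ⊕ B), σ[k]? = some e → σ[k + 1]? = some e' →
    e.isRight → ¬ Legal dur H d ((σ.set k e').set (k + 1) e)

section Policy

variable {n m : ℕ} {B : Type*}

lemma compCount_succ_inl {σ : List (Fin n ⊕ B)} {k : ℕ} {i : Fin n}
    (h : σ[k]? = some (Sum.inl i)) : compCount σ (k + 1) = compCount σ k + 1 := by
  simp [compCount, List.take_add_one, h]

lemma compCount_succ_inr {σ : List (Fin n ⊕ B)} {k : ℕ} {b : B}
    (h : σ[k]? = some (Sum.inr b)) : compCount σ (k + 1) = compCount σ k := by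
  simp [compCount, List.take_add_one, h]

lemma baseCount_succ_inl {σ : List (Fin n ⊕ B)} {k : ℕ} {i : Fin n}
    (h : σ[k]? = some (Sum.inl i)) : baseCount σ (k + 1) = baseCount σ k := by
  simp [baseCount, List.take_add_one, h]

lemma baseCount_succ_inr {σ : List (Fin n ⊕ B)} {k : ℕ} {b : B}
    (h : σ[k]? = some (Sum.inr b)) : baseCount σ (k + 1) = baseCount σ k + 1 := by
  simp [baseCount, List.take_add_one, h]

lemma baseSeq_take_succ_inr {σ : List (Fin n ⊕ B)} {k : ℕ} {b : B}
    (h : σ[k]? = some (Sum.inr b)) :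
    baseSeq (σ.take (k + 1)) = baseSeq (σ.take k) ++ [b] := by
  simp [baseSeq, List.take_add_one, h]

lemma length_baseSeq (σ : List (Fin n ⊕ B)) : (baseSeq σ).length = σ.countP Sum.isRight := by
  induction σ with
  | nil => rfl
  | cons e σ ih => cases e <;> simpa [baseSeq, List.filterMap_cons, List.countP_cons] using ih

lemma length_baseSeq_take (σ : List (Fin n ⊕ B)) (k : ℕ) :
    (baseSeq (σ.take k)).length = baseCount σ k :=
  length_baseSeq _

lemma baseSeq_take_prefix (σ : List (Fin n ⊕ B)) {k l : ℕ} (h : k ≤ l) :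
    baseSeq (σ.take k) <+: baseSeq (σ.take l) :=
  (List.take_prefix_take_left h).filterMap _

lemma finishBound_succ_inl (dur : B → ℕ) {σ : List (Fin n ⊕ B)} {k : ℕ} {i : Fin n}
    (h : σ[k]? = some (Sum.inl i)) : finishBound dur σ (k + 1) = finishBound dur σ k := by
  simp [finishBound, Finset.range_add_one, h]

lemma finishBound_succ_inr (dur : B → ℕ) {σ : List (Fin n ⊕ B)} {k : ℕ} {b : B}
    (h : σ[k]? = some (Sum.inr b)) :
    finishBound dur σ (k + 1) = max (compCount σ k + dur b) (finishBound dur σ k) := by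
  simp [finishBound, Finset.range_add_one, h]

/-- The computation entry `c i` would be valid and non-tardy at position `k` of `σ`. -/
def Admissible (dur : B → ℕ) (H : Fin m → List B) (d : Fin m → ℕ)
    (σ : List (Fin n ⊕ B)) (k : ℕ) (i : Fin m) : Prop :=
  baseSeq (σ.take k) <+: H i ∧
    max (compCount σ k + 1) (finishBound dur σ k) + remDur dur (H i) (baseCount σ k) ≤ d i

/-- Base-level executions do not overlap. -/
def NonOverlapping (dur : B → ℕ) (σ : List (Fin n ⊕ B)) : Prop :=
  ∀ q (b : B), σ[q]? = some (Sum.inr b) → finishBound dur σ q ≤ compCount σ q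

lemma remDur_of_prefix (dur : B → ℕ) {l Hi : List B} {b : B} (h : l ++ [b] <+: Hi) :
    remDur dur Hi l.length = dur b + remDur dur Hi (l.length + 1) := by
  obtain ⟨t, rfl⟩ := h
  simp [remDur, List.append_assoc, ← List.drop_drop]

/-- The earliest completion time of `Hi` from position `k` on does not decrease with `k`. -/
lemma NonOverlapping.completion_mono {dur : B → ℕ} {σ : List (Fin n ⊕ B)}
    (hσ : NonOverlapping dur σ) {Hi : List B} {k l : ℕ} (hkl : k ≤ l) (hl : l ≤ σ.length)
    (hpre : baseSeq (σ.take l) <+: Hi) :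
    max (compCount σ k) (finishBound dur σ k) + remDur dur Hi (baseCount σ k) ≤
      max (compCount σ l) (finishBound dur σ l) + remDur dur Hi (baseCount σ l) := by
  induction l, hkl using Nat.le_induction with
  | base => rfl
  | succ l hkl ih =>
    refine (ih (by omega) ((baseSeq_take_prefix σ l.le_succ).trans hpre)).trans ?_
    have hget : σ[l]? = some σ[l] := List.getElem?_eq_getElem (by omega)
    rcases he : σ[l] with i | b <;> rw [he] at hget
    · rw [compCount_succ_inl hget, baseCount_succ_inl hget, finishBound_succ_inl dur hget]
      omega
    · have hno := hσ l b hget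
      rw [baseSeq_take_succ_inr hget] at hpre
      have hrem := remDur_of_prefix dur hpre
      rw [length_baseSeq_take] at hrem
      rw [compCount_succ_inr hget, baseCount_succ_inr hget, finishBound_succ_inr dur hget, hrem]
      omega

lemma Admissible.of_le {dur : B → ℕ} {H : Fin m → List B} {d : Fin m → ℕ}
    {σ : List (Fin n ⊕ B)} (hσ : NonOverlapping dur σ) {k q : ℕ} {i : Fin m} {i' : Fin n}
    (hk : σ[k]? = some (Sum.inl i')) (hkq : k ≤ q) (hq : q < σ.length)
    (h : Admissible dur H d σ q i) : Admissible dur H d σ k i := by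
  rcases hkq.eq_or_lt with rfl | hlt
  · exact h
  refine ⟨(baseSeq_take_prefix σ hkq).trans h.1, ?_⟩
  have hmono := hσ.completion_mono (Nat.succ_le_of_lt hlt) hq.le h.1
  rw [Nat.succ_eq_add_one, compCount_succ_inl hk, baseCount_succ_inl hk,
    finishBound_succ_inl dur hk] at hmono
  have := h.2
  omega

/-- Forget which process each computation entry belongs to. -/
def skeleton (σ : List (Fin n ⊕ B)) : List (Fin 1 ⊕ B) :=
  σ.map (Sum.map (fun _ => 0) id)

lemma compCount_skeleton (σ : List (Fin n ⊕ B)) (k : ℕ) :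
    compCount (skeleton σ) k = compCount σ k := by
  simp only [compCount, skeleton, ← List.map_take, List.countP_map]
  congr 1; ext e; cases e <;> rfl

lemma baseCount_skeleton (σ : List (Fin n ⊕ B)) (k : ℕ) :
    baseCount (skeleton σ) k = baseCount σ k := by
  simp only [baseCount, skeleton, ← List.map_take, List.countP_map]
  congr 1; ext e; cases e <;> rfl

lemma baseSeq_skeleton (σ : List (Fin n ⊕ B)) : baseSeq (skeleton σ) = baseSeq σ := by
  simp only [baseSeq, skeleton, List.filterMap_map]
  congr 1; ext e; cases e <;> rfl

lemma skeleton_take (σ : List (Fin n ⊕ B)) (k : ℕ) :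
    skeleton (σ.take k) = (skeleton σ).take k :=
  List.map_take

lemma skeleton_getElem?_inr (σ : List (Fin n ⊕ B)) (k : ℕ) (b : B) :
    (skeleton σ)[k]? = some (Sum.inr b) ↔ σ[k]? = some (Sum.inr b) := by
  simp [skeleton]

lemma finishBound_skeleton (dur : B → ℕ) (σ : List (Fin n ⊕ B)) (k : ℕ) :
    finishBound dur (skeleton σ) k = finishBound dur σ k := by
  refine Finset.sup_congr rfl fun p _ => ?_
  rw [compCount_skeleton]
  simp only [skeleton, List.getElem?_map]
  rcases σ[p]? with _ | _ | _ <;> rfl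

lemma admissible_skeleton (dur : B → ℕ) (H : Fin m → List B) (d : Fin m → ℕ)
    (σ : List (Fin n ⊕ B)) (k : ℕ) (i : Fin m) :
    Admissible dur H d (skeleton σ) k i ↔ Admissible dur H d σ k i := by
  simp only [Admissible, compCount_skeleton, baseCount_skeleton, finishBound_skeleton,
    ← skeleton_take, baseSeq_skeleton]

lemma nonOverlapping_skeleton (dur : B → ℕ) (σ : List (Fin n ⊕ B)) :
    NonOverlapping dur (skeleton σ) ↔ NonOverlapping dur σ := by
  simp only [NonOverlapping, compCount_skeleton, finishBound_skeleton, skeleton_getElem?_inr]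

lemma Legal.of_skeleton_eq {dur : B → ℕ} {H : Fin n → List B} {d : Fin n → ℕ}
    {σ τ : List (Fin n ⊕ B)} (hσ : Legal dur H d σ) (hsk : skeleton τ = skeleton σ)
    (hτ : ∀ k i, τ[k]? = some (Sum.inl i) → Admissible dur H d σ k i) : Legal dur H d τ := by
  refine ⟨?_, ?_, fun k i hk => ?_⟩
  · rw [← baseSeq_skeleton τ, hsk, baseSeq_skeleton]
    exact hσ.1
  · exact (nonOverlapping_skeleton dur τ).1 (hsk ▸ (nonOverlapping_skeleton dur σ).2 hσ.2.1)
  · exact (admissible_skeleton dur H d τ k i).1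
      (hsk ▸ (admissible_skeleton dur H d σ k i).2 (hτ k i hk))

/-- The list `σ` with the entries at positions `p` and `q` replaced by `e'` and `e`; this is
a swap when these were `e` and `e'`. -/
abbrev setTwo {α : Type*} (σ : List α) (p q : ℕ) (e e' : α) : List α :=
  (σ.set p e').set q e

lemma setTwo_getElem? {α : Type*} {σ : List α} {p q : ℕ} {e e' : α}
    (hp : σ[p]? = some e) (hq : σ[q]? = some e') (k : ℕ) :
    (setTwo σ p q e e')[k]? = if k = q then some e else if k = p then some e' else σ[k]? := by
  have hp' := (List.getElem?_eq_some_iff.1 hp).1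
  have hq' := (List.getElem?_eq_some_iff.1 hq).1
  simp only [setTwo, List.getElem?_set, List.length_set]
  grind

lemma setTwo_perm {α : Type*} {σ : List α} {p q : ℕ} {e e' : α}
    (hp : σ[p]? = some e) (hq : σ[q]? = some e') : (setTwo σ p q e e').Perm σ := by
  obtain ⟨hp', rfl⟩ := List.getElem?_eq_some_iff.1 hp
  obtain ⟨hq', rfl⟩ := List.getElem?_eq_some_iff.1 hq
  exact List.set_set_perm hp' hq'

/-- The sum of the positions of the entries of `σ`, weighted by `w`. -/
def weightedPos {α : Type*} (w : α → ℕ) (σ : List α) : ℕ :=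
  ∑ k ∈ Finset.range σ.length, k * (σ[k]?).elim 0 w

lemma weightedPos_lt_setTwo {α : Type*} (w : α → ℕ) {σ : List α} {p q : ℕ} {e e' : α}
    (hpq : p < q) (hp : σ[p]? = some e) (hq : σ[q]? = some e') (hw : w e' < w e) :
    weightedPos w σ < weightedPos w (setTwo σ p q e e') := by
  have hq' : q ∈ Finset.range σ.length :=
    Finset.mem_range.2 (List.getElem?_eq_some_iff.1 hq).1
  have hp' : p ∈ (Finset.range σ.length).erase q :=
    Finset.mem_erase.2 ⟨hpq.ne, Finset.mem_range.2 (List.getElem?_eq_some_iff.1 hp).1⟩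
  have hlen : (setTwo σ p q e e').length = σ.length := by simp [setTwo]
  simp only [weightedPos, hlen]
  rw [← Finset.add_sum_erase _ _ hq', ← Finset.add_sum_erase _ _ hp',
    ← Finset.add_sum_erase _ _ hq', ← Finset.add_sum_erase _ _ hp']
  have hrest : ∀ k ∈ ((Finset.range σ.length).erase q).erase p,
      k * ((setTwo σ p q e e')[k]?).elim 0 w = k * (σ[k]?).elim 0 w := by
    intro k hk
    simp only [Finset.mem_erase] at hk
    rw [setTwo_getElem? hp hq, if_neg hk.2.1, if_neg hk.1]
  rw [Finset.sum_congr rfl hrest, setTwo_getElem? hp hq, setTwo_getElem? hp hq, hp, hq]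
  simp only [if_true, if_neg hpq.ne, Option.elim]
  nlinarith

lemma exists_max_of_perm {α : Type*} (P : List α → Prop) (f : List α → ℕ) {σ : List α}
    (hσ : P σ) : ∃ τ, τ.Perm σ ∧ P τ ∧ ∀ ρ, ρ.Perm σ → P ρ → f ρ ≤ f τ := by
  have hfin : {τ : List α | τ.Perm σ ∧ P τ}.Finite :=
    (List.finite_toSet σ.permutations).subset fun τ hτ => List.mem_permutations.2 hτ.1
  obtain ⟨τ, hτ, hmax⟩ := Set.exists_max_image _ f hfin ⟨σ, .refl σ, hσ⟩
  exact ⟨τ, hτ.1, hτ.2, fun ρ h₁ h₂ => hmax ρ ⟨h₁, h₂⟩⟩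

lemma policyP_congr [DecidableEq B] (M : Fin n → ℕ → ℝ) {σ τ : List (Fin n ⊕ B)}
    (h : σ.Perm τ) : policyP M σ = policyP M τ := by
  simp only [policyP, h.count_eq]

/-- Exchanging two computation entries does not change the skeleton. -/
lemma skeleton_setTwo {σ : List (Fin n ⊕ B)} {p q : ℕ} {i j : Fin n}
    (hp : σ[p]? = some (Sum.inl i)) (hq : σ[q]? = some (Sum.inl j)) :
    skeleton (setTwo σ p q (Sum.inl i) (Sum.inl j)) = skeleton σ := by
  refine List.ext_getElem? fun k => ?_
  simp only [skeleton, List.getElem?_map, setTwo_getElem? hp hq]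
  split_ifs with h₁ h₂
  · subst h₁; simp [hq]
  · subst h₂; simp [hp]
  · rfl

open Classical in
/-- The number of computation positions of `σ` at which process `i` is admissible. -/
noncomputable def slack (dur : B → ℕ) (H : Fin n → List B) (d : Fin n → ℕ)
    (σ : List (Fin n ⊕ B)) (i : Fin n) : ℕ :=
  ((Finset.range σ.length).filter fun k =>
    (∃ i' : Fin n, σ[k]? = some (Sum.inl i')) ∧ Admissible dur H d σ k i).card

lemma Admissible.of_slack_le {dur : B → ℕ} {H : Fin n → List B} {d : Fin n → ℕ}
    {σ : List (Fin n ⊕ B)} (hσ : NonOverlapping dur σ) {q : ℕ} {i j i' : Fin n}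
    (hq : σ[q]? = some (Sum.inl i')) (hj : Admissible dur H d σ q j)
    (hle : slack dur H d σ j ≤ slack dur H d σ i) : Admissible dur H d σ q i := by
  have hqlen := (List.getElem?_eq_some_iff.1 hq).1
  by_contra hi
  refine hle.not_gt (Finset.card_lt_card (Finset.ssubset_iff_of_subset ?_ |>.2 ⟨q, ?_, ?_⟩))
  · intro k hk
    simp only [Finset.mem_filter, Finset.mem_range] at hk ⊢
    obtain ⟨hklen, ⟨i'', hk'⟩, hadm⟩ := hk
    refine ⟨hklen, ⟨i'', hk'⟩, hj.of_le hσ hk' ?_ hqlen⟩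
    by_contra! hlt
    exact hi (hadm.of_le hσ hq hlt.le hklen)
  · simp only [Finset.mem_filter, Finset.mem_range]
    exact ⟨hqlen, ⟨i', hq⟩, hj⟩
  · simp [hi]

/-- Every legal policy can be rearranged into a contiguous one, by the
earliest-deadline-first rule. -/
lemma Legal.exists_contiguous_perm {dur : B → ℕ} {H : Fin n → List B} {d : Fin n → ℕ}
    {σ : List (Fin n ⊕ B)} (hσ : Legal dur H d σ) :
    ∃ τ, τ.Perm σ ∧ Legal dur H d τ ∧ Contiguous τ := by
  let key : Fin n → ℕ := fun i => slack dur H d σ i * n + i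
  have key_le {i j : Fin n} (h : key j < key i) : slack dur H d σ j ≤ slack dur H d σ i := by
    by_contra! hlt
    have := Nat.mul_le_mul_right n (Nat.succ_le_of_lt hlt)
    have := i.isLt
    simp only [key, Nat.succ_mul] at *
    omega
  have key_inj {i j : Fin n} (h : key i = key j) : i = j := by
    have := congrArg (· % n) h
    simpa [key, Nat.mod_eq_of_lt, Fin.ext_iff] using this
  obtain ⟨τ, hperm, ⟨hsk, hadm⟩, hmax⟩ := exists_max_of_perm
    (fun τ => skeleton τ = skeleton σ ∧
      ∀ k i, τ[k]? = some (Sum.inl i) → Admissible dur H d σ k i)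
    (weightedPos (Sum.elim key fun _ => 0)) ⟨rfl, hσ.2.2⟩
  have hcomp {k : ℕ} {i : Fin n} (h : τ[k]? = some (Sum.inl i)) :
      ∃ i' : Fin n, σ[k]? = some (Sum.inl i') := by
    have := congrArg (·[k]?) hsk
    simp only [skeleton, List.getElem?_map, h, Option.map_some] at this
    rcases hk : σ[k]? with _ | i' | b <;> simp_all
  have hsorted {p q : ℕ} {i j : Fin n} (hpq : p < q) (hp : τ[p]? = some (Sum.inl i))
      (hq : τ[q]? = some (Sum.inl j)) : key i ≤ key j := by
    by_contra! hlt
    refine (weightedPos_lt_setTwo (Sum.elim key fun _ => 0) hpq hp hq hlt).not_ge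
      (hmax _ ((setTwo_perm hp hq).trans hperm) ⟨(skeleton_setTwo hp hq).trans hsk, ?_⟩)
    intro k l hk
    obtain ⟨i', hq'⟩ := hcomp hq
    obtain ⟨j', hp'⟩ := hcomp hp
    rw [setTwo_getElem? hp hq] at hk
    split_ifs at hk with h₁ h₂
    · obtain rfl : i = l := by simpa using hk
      subst h₁
      exact (hadm k j hq).of_slack_le hσ.2.1 hq' (key_le hlt)
    · obtain rfl : j = l := by simpa using hk
      subst h₂
      exact (hadm q j hq).of_le hσ.2.1 hp' hpq.le (List.getElem?_eq_some_iff.1 hq').1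
    · exact hadm k l hk
  exact ⟨τ, hperm, hσ.of_skeleton_eq hsk hadm, fun p q r i j hpq hqr hp hr hq =>
    key_inj ((hsorted hqr hq hr).antisymm (hsorted hpq hp hq))⟩

/-- Exchanging a base-level entry with the computation entry following it preserves
contiguity. -/
lemma Contiguous.setTwo {σ : List (Fin n ⊕ B)} (hσ : Contiguous σ) {k : ℕ} {b : B} {j : Fin n}
    (hb : σ[k]? = some (Sum.inr b)) (hj : σ[k + 1]? = some (Sum.inl j)) :
    Contiguous (setTwo σ k (k + 1) (Sum.inr b) (Sum.inl j)) := by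
  have hpos {p : ℕ} {i : Fin n}
      (h : (_root_.setTwo σ k (k + 1) (Sum.inr b) (Sum.inl j))[p]? = some (Sum.inl i)) :
      p ≠ k + 1 ∧ σ[if p = k then k + 1 else p]? = some (Sum.inl i) := by
    rw [setTwo_getElem? hb hj] at h
    grind
  intro p q r i l hpq hqr hp hr hq
  obtain ⟨hp₁, hp₂⟩ := hpos hp
  obtain ⟨hq₁, hq₂⟩ := hpos hq
  obtain ⟨hr₁, hr₂⟩ := hpos hr
  refine hσ _ _ _ i l ?_ ?_ hp₂ hr₂ hq₂ <;> split_ifs <;> omega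

/-- Two base-level entries of a policy without overlaps are never adjacent. -/
lemma NonOverlapping.not_adjacent {dur : B → ℕ} (hdur : ∀ b, 1 ≤ dur b)
    {σ : List (Fin n ⊕ B)} (hσ : NonOverlapping dur σ) {k : ℕ} {b b' : B}
    (hb : σ[k]? = some (Sum.inr b)) : σ[k + 1]? ≠ some (Sum.inr b') := by
  intro hb'
  have h := hσ _ _ hb'
  rw [finishBound_succ_inr dur hb, compCount_succ_inr hb] at h
  have := hdur b
  omega

lemma Legal.exists_contiguous_lazy_perm {dur : B → ℕ} (hdur : ∀ b, 1 ≤ dur b)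
    {H : Fin n → List B} {d : Fin n → ℕ} {σ : List (Fin n ⊕ B)} (hσ : Legal dur H d σ) :
    ∃ τ, τ.Perm σ ∧ Legal dur H d τ ∧ Contiguous τ ∧ Lazy dur H d τ := by
  obtain ⟨ρ, hρσ, hρ⟩ := hσ.exists_contiguous_perm
  let w : Fin n ⊕ B → ℕ := Sum.elim (fun _ => 0) fun _ => 1
  obtain ⟨τ, hperm, ⟨hlegal, hcont⟩, hmax⟩ := exists_max_of_perm
    (fun τ => Legal dur H d τ ∧ Contiguous τ) (weightedPos w) hρ
  refine ⟨τ, hperm.trans hρσ, hlegal, hcont, ?_⟩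
  rintro k (i | b) e' hk hk' he hswap
  · simp at he
  rcases e' with j | b'
  · exact (weightedPos_lt_setTwo w k.lt_succ_self hk hk' (by simp [w])).not_ge
      (hmax _ ((setTwo_perm hk hk').trans hperm) ⟨hswap, hcont.setTwo hk hk'⟩)
  · exact NonOverlapping.not_adjacent hdur hlegal.2.1 hk hk'

lemma Legal.compCount_le {dur : B → ℕ} {H : Fin n → List B} {d : Fin n → ℕ}
    {σ : List (Fin n ⊕ B)} (hσ : Legal dur H d σ) {k : ℕ} (hk : k ≤ σ.length) :
    compCount σ k ≤ ∑ i, d i := by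
  induction k with
  | zero => simp [compCount]
  | succ k ih =>
    have hget : σ[k]? = some σ[k] := List.getElem?_eq_getElem (by omega)
    rcases he : σ[k] with i | b <;> rw [he] at hget
    · have h := (hσ.2.2 k i hget).2
      have := Finset.single_le_sum (f := d) (fun _ _ => Nat.zero_le _) (Finset.mem_univ i)
      rw [compCount_succ_inl hget]
      omega
    · rw [compCount_succ_inr hget]
      exact ih (by omega)

lemma Legal.length_le {dur : B → ℕ} {H : Fin n → List B} {d : Fin n → ℕ}
    {σ : List (Fin n ⊕ B)} (hσ : Legal dur H d σ) :
    σ.length ≤ ∑ i, d i + ∑ i, (H i).length := by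
  obtain ⟨i, hi⟩ := hσ.1
  have hbase := hi.length_le
  rw [length_baseSeq] at hbase
  have hsum := Finset.single_le_sum (f := fun i => (H i).length) (fun _ _ => Nat.zero_le _)
    (Finset.mem_univ i)
  have hcomp := hσ.compCount_le le_rfl
  rw [compCount, List.take_length] at hcomp
  have hlen := List.length_eq_countP_add_countP (l := σ) Sum.isLeft
  have hnot : (fun e : Fin n ⊕ B => decide ¬ e.isLeft = true) = Sum.isRight := by
    ext e; cases e <;> rfl
  rw [hnot] at hlen
  omega

lemma finite_setOf_legal [Finite B] (dur : B → ℕ) (H : Fin n → List B) (d : Fin n → ℕ) :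
    {σ | Legal dur H d σ}.Finite :=
  (List.finite_length_le (Fin n ⊕ B) _).subset fun _ hσ => Legal.length_le hσ

lemma legal_nil (hn : 0 < n) (dur : B → ℕ) (H : Fin n → List B) (d : Fin n → ℕ) :
    Legal dur H d [] :=
  ⟨⟨⟨0, hn⟩, by simp [baseSeq]⟩, by simp, by simp⟩

end Policy

/-- Theorem 5, concretized: every KID-CoPE instance admits an optimal legal linear
policy that is contiguous and lazy. -/
theorem stmt10 {B : Type*} [DecidableEq B] [Fintype B] (n : ℕ) (hn : 0 < n)
    (dur : B → ℕ) (hdur : ∀ b, 1 ≤ dur b)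
    (H : Fin n → List B) (d : Fin n → ℕ) (M : Fin n → ℕ → ℝ)
    (hMmono : ∀ i, Monotone (M i)) (hM0 : ∀ i, M i 0 = 0)
    (hM01 : ∀ i t, 0 ≤ M i t ∧ M i t ≤ 1) :
    ∃ σstar : List (Fin n ⊕ B), Legal dur H d σstar ∧ Contiguous σstar ∧
      Lazy dur H d σstar ∧
      ∀ σ : List (Fin n ⊕ B), Legal dur H d σ → policyP M σ ≤ policyP M σstar := by
  obtain ⟨σ, hσ, hmax⟩ := Set.exists_max_image _ (policyP M) (finite_setOf_legal dur H d)
    ⟨[], legal_nil hn dur H d⟩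
  obtain ⟨τ, hperm, hlegal, hcont, hlazy⟩ := Legal.exists_contiguous_lazy_perm hdur hσ
  exact ⟨τ, hlegal, hcont, hlazy, fun ρ hρ => (hmax ρ hρ).trans_eq (policyP_congr M hperm).symm⟩
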